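/- For any sequence of bipartite states ρ^{AB} = {ρ^{AB}_n} in which the Hilbert spaces H^A_n of system A have dimension d^n, the conditional spectral entropy rates are bounded by −log d ≤ −S̄(A) ≤ S̲(A|B) ≤ S̄(A|B) ≤ log d. -/

import Mathlib

open scoped Kronecker ComplexOrder
open Filter Matrix

/-- The spectral projection `{A ≥ 0}` onto the span of eigenvectors of `A` with
nonnegative eigenvalues, for a Hermitian matrix `A` (junk value `0` otherwise). -/
noncomputable def specProj {ι : Type*} [Fintype ι] [DecidableEq ι] (A : Matrix ι ι ℂ) :
    Matrix ι ι ℂ :=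
  if hA : A.IsHermitian then
    (Matrix.IsHermitian.eigenvectorUnitary hA : Matrix ι ι ℂ) *
      Matrix.diagonal (fun i => if 0 ≤ hA.eigenvalues i then (1 : ℂ) else 0) *
      star (Matrix.IsHermitian.eigenvectorUnitary hA : Matrix ι ι ℂ)
  else 0

/-- A density matrix: positive semidefinite with unit trace. -/
def IsState {ι : Type*} [Fintype ι] (ρ : Matrix ι ι ℂ) : Prop :=
  ρ.PosSemidef ∧ ρ.trace = 1

/-- `Tr[{ρ - c ω ≥ 0} (ρ - c ω)]` as a real number. -/
noncomputable def projTrace {ι : Type*} [Fintype ι] [DecidableEq ι]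
    (ρ ω : Matrix ι ι ℂ) (c : ℝ) : ℝ :=
  ((specProj (ρ - (c : ℂ) • ω) * (ρ - (c : ℂ) • ω)).trace).re

/-- The quantum spectral sup-divergence rate `D̄(ρ‖ω)`. -/
noncomputable def Dsup {ι : ℕ → Type} [∀ n, Fintype (ι n)] [∀ n, DecidableEq (ι n)]
    (ρ ω : ∀ n, Matrix (ι n) (ι n) ℂ) : ℝ :=
  sInf {γ : ℝ | Tendsto (fun n : ℕ => projTrace (ρ n) (ω n) (Real.exp (n * γ)))
    atTop (nhds 0)}

/-- The quantum spectral inf-divergence rate `D̲(ρ‖ω)`. -/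
noncomputable def Dinf {ι : ℕ → Type} [∀ n, Fintype (ι n)] [∀ n, DecidableEq (ι n)]
    (ρ ω : ∀ n, Matrix (ι n) (ι n) ℂ) : ℝ :=
  sSup {γ : ℝ | Tendsto (fun n : ℕ => projTrace (ρ n) (ω n) (Real.exp (n * γ)))
    atTop (nhds 1)}

/-- The sup-spectral entropy rate `S̄`. -/
noncomputable def Ssup {ι : ℕ → Type} [∀ n, Fintype (ι n)] [∀ n, DecidableEq (ι n)]
    (ρ : ∀ n, Matrix (ι n) (ι n) ℂ) : ℝ :=
  - Dinf ρ (fun _ => 1)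

/-- The inf-spectral entropy rate `S̲`. -/
noncomputable def Sinf {ι : ℕ → Type} [∀ n, Fintype (ι n)] [∀ n, DecidableEq (ι n)]
    (ρ : ∀ n, Matrix (ι n) (ι n) ℂ) : ℝ :=
  - Dsup ρ (fun _ => 1)

/-- Partial trace over the second tensor factor. -/
noncomputable def ptraceSnd {a b : Type*} [Fintype b]
    (M : Matrix (a × b) (a × b) ℂ) : Matrix a a ℂ :=
  Matrix.of fun i j => ∑ k : b, M (i, k) (j, k)

/-- Partial trace over the first tensor factor. -/
noncomputable def ptraceFst {a b : Type*} [Fintype a]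
    (M : Matrix (a × b) (a × b) ℂ) : Matrix b b ℂ :=
  Matrix.of fun i j => ∑ k : a, M (k, i) (k, j)

/-- Partial trace over the third tensor factor of a tripartite system. -/
noncomputable def ptraceThird {a b c : Type*} [Fintype c]
    (M : Matrix (a × b × c) (a × b × c) ℂ) : Matrix (a × b) (a × b) ℂ :=
  Matrix.of fun i j => ∑ k : c, M (i.1, i.2, k) (j.1, j.2, k)

/-- A completely positive trace preserving map, given by a Kraus representation. -/
def IsCPTP {ι κ : Type*} [Fintype ι] [Fintype κ] [DecidableEq ι]
    (T : Matrix ι ι ℂ →ₗ[ℂ] Matrix κ κ ℂ) : Prop :=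
  ∃ (r : ℕ) (K : Fin r → Matrix κ ι ℂ),
    (∀ X, T X = ∑ k, K k * X * (K k)ᴴ) ∧ (∑ k, (K k)ᴴ * K k = 1)


theorem specProj_herm {ι : Type*} [Fintype ι] [DecidableEq ι] (A : Matrix ι ι ℂ) :
    (specProj A)ᴴ = specProj A := by
  unfold specProj
  split_ifs with hA
  · rw [star_eq_conjTranspose, conjTranspose_mul, conjTranspose_mul, conjTranspose_conjTranspose,
      diagonal_conjTranspose, Matrix.mul_assoc]
    congr 3
    funext i
    simp only [Pi.star_apply]
    split_ifs <;> simp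
  · simp

theorem specProj_idem {ι : Type*} [Fintype ι] [DecidableEq ι] (A : Matrix ι ι ℂ) :
    specProj A * specProj A = specProj A := by
  unfold specProj
  split_ifs with hA
  · have h : star (hA.eigenvectorUnitary : Matrix ι ι ℂ) * hA.eigenvectorUnitary = 1 := by
      simp
    set U := (hA.eigenvectorUnitary : Matrix ι ι ℂ)
    set D := Matrix.diagonal (fun i => if 0 ≤ hA.eigenvalues i then (1 : ℂ) else 0) with hD
    have hDD : D * D = D := by
      rw [hD, diagonal_mul_diagonal]
      congr 1
      funext i
      split_ifs <;> simp
    calc U * D * star U * (U * D * star U) = U * D * (star U * U) * D * star U := by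
          simp only [Matrix.mul_assoc]
      _ = U * (D * D) * star U := by rw [h]; simp only [Matrix.mul_assoc, Matrix.mul_one]
      _ = _ := by rw [hDD]
  · simp

theorem trace_proj_nonneg {ι : Type*} [Fintype ι] [DecidableEq ι] {R X : Matrix ι ι ℂ}
    (hR : Rᴴ = R) (hRR : R * R = R) (hX : X.PosSemidef) : 0 ≤ ((R * X).trace).re := by
  have h : (R * X).trace = (R * X * Rᴴ).trace := by
    rw [hR, Matrix.trace_mul_cycle, hRR]
  rw [h]
  have := (hX.mul_mul_conjTranspose_same R).trace_nonneg
  exact (Complex.le_def.1 this).1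

theorem trace_proj_le {ι : Type*} [Fintype ι] [DecidableEq ι] {R X : Matrix ι ι ℂ}
    (hR : Rᴴ = R) (hRR : R * R = R) (hX : X.PosSemidef) :
    ((R * X).trace).re ≤ (X.trace).re := by
  have := trace_proj_nonneg (R := 1 - R) (X := X) (by simp [hR])
    (by simp [Matrix.sub_mul, Matrix.mul_sub, hRR]) hX
  rw [Matrix.sub_mul, Matrix.trace_sub, Matrix.one_mul, Complex.sub_re] at this
  linarith

/-- Positive and negative part decomposition. -/
theorem specProj_decomp {ι : Type*} [Fintype ι] [DecidableEq ι] {A : Matrix ι ι ℂ}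
    (hA : A.IsHermitian) :
    (specProj A * A).PosSemidef ∧ (specProj A * A - A).PosSemidef := by
  have h : star (hA.eigenvectorUnitary : Matrix ι ι ℂ) * hA.eigenvectorUnitary = 1 := by
    simp
  have hs : A = (hA.eigenvectorUnitary : Matrix ι ι ℂ) *
      diagonal (fun i => (hA.eigenvalues i : ℂ)) * star (hA.eigenvectorUnitary : Matrix ι ι ℂ) := by
    have := hA.spectral_theorem
    rw [Unitary.conjStarAlgAut_apply] at this
    exact this
  have hP : specProj A = (hA.eigenvectorUnitary : Matrix ι ι ℂ) *
      Matrix.diagonal (fun i => if 0 ≤ hA.eigenvalues i then (1 : ℂ) else 0) *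
      star (hA.eigenvectorUnitary : Matrix ι ι ℂ) := by
    unfold specProj; rw [dif_pos hA]
  have hPA : specProj A * A = (hA.eigenvectorUnitary : Matrix ι ι ℂ) *
      diagonal (fun i => ((max (hA.eigenvalues i) 0 : ℝ) : ℂ)) *
      (hA.eigenvectorUnitary : Matrix ι ι ℂ)ᴴ := by
    rw [hP]
    generalize hA.eigenvalues = ev at *
    generalize (hA.eigenvectorUnitary : Matrix ι ι ℂ) = U at *
    rw [hs]
    calc _ = U * diagonal (fun i => if 0 ≤ ev i then (1 : ℂ) else 0) * (star U * U) *
          diagonal (fun i => (ev i : ℂ)) * star U := by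
          simp only [Matrix.mul_assoc]
      _ = _ := by
          rw [h, Matrix.mul_one, Matrix.mul_assoc U, diagonal_mul_diagonal,
            star_eq_conjTranspose]
          congr 3
          funext i
          split_ifs with h0
          · rw [max_eq_left h0, one_mul]
          · rw [max_eq_right (not_le.1 h0).le]; simp
  constructor
  · rw [hPA]
    refine PosSemidef.mul_mul_conjTranspose_same (PosSemidef.diagonal ?_) _
    intro i
    simp
  · have : specProj A * A - A = (hA.eigenvectorUnitary : Matrix ι ι ℂ) *
      diagonal (fun i => ((max (hA.eigenvalues i) 0 - hA.eigenvalues i : ℝ) : ℂ)) *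
      (hA.eigenvectorUnitary : Matrix ι ι ℂ)ᴴ := by
      rw [hPA]
      nth_rw 4 [hs]
      rw [star_eq_conjTranspose, ← Matrix.sub_mul, ← Matrix.mul_sub, diagonal_sub]
      simp
    rw [this]
    refine PosSemidef.mul_mul_conjTranspose_same (PosSemidef.diagonal ?_) _
    intro i
    simp only [Pi.zero_apply]
    exact_mod_cast sub_nonneg.2 (le_max_left _ _)

theorem trace_mul_le_specProj {ι : Type*} [Fintype ι] [DecidableEq ι] {A R : Matrix ι ι ℂ}
    (hA : A.IsHermitian) (hR : Rᴴ = R) (hRR : R * R = R) :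
    ((R * A).trace).re ≤ ((specProj A * A).trace).re := by
  obtain ⟨h1, h2⟩ := specProj_decomp hA
  have a := trace_proj_nonneg hR hRR h2
  have b := trace_proj_le hR hRR h1
  rw [Matrix.mul_sub, Matrix.trace_sub, Complex.sub_re] at a
  linarith

theorem herm_sub {ι : Type*} [Fintype ι] [DecidableEq ι] {ρ ω : Matrix ι ι ℂ}
    (hρ : ρ.PosSemidef) (hω : ω.PosSemidef) (c : ℝ) : (ρ - (c : ℂ) • ω).IsHermitian := by
  unfold Matrix.IsHermitian
  rw [conjTranspose_sub, conjTranspose_smul, hρ.1.eq, hω.1.eq]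
  simp

theorem smul_psd {ι : Type*} [Fintype ι] [DecidableEq ι] {ω : Matrix ι ι ℂ}
    (hω : ω.PosSemidef) {c : ℝ} (hc : 0 ≤ c) : ((c : ℂ) • ω).PosSemidef :=
  hω.smul (by exact_mod_cast hc)

theorem projTrace_nonneg {ι : Type*} [Fintype ι] [DecidableEq ι] {ρ ω : Matrix ι ι ℂ}
    (hρ : ρ.PosSemidef) (hω : ω.PosSemidef) (c : ℝ) : 0 ≤ projTrace ρ ω c := by
  have := trace_mul_le_specProj (R := 0) (herm_sub hρ hω c) (by simp) (by simp)
  simpa [projTrace] using this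

theorem projTrace_ge {ι : Type*} [Fintype ι] [DecidableEq ι] {ρ ω : Matrix ι ι ℂ}
    (hρ : ρ.PosSemidef) (hω : ω.PosSemidef) (c : ℝ) :
    ρ.trace.re - c * ω.trace.re ≤ projTrace ρ ω c := by
  have := trace_mul_le_specProj (R := 1) (herm_sub hρ hω c) (by simp) (by simp)
  simpa [projTrace] using this

theorem projTrace_le {ι : Type*} [Fintype ι] [DecidableEq ι] {ρ ω X : Matrix ι ι ℂ}
    {c : ℝ} (hX : X.PosSemidef) (h : (X - (ρ - (c : ℂ) • ω)).PosSemidef) :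
    projTrace ρ ω c ≤ X.trace.re := by
  have h1 := trace_proj_nonneg (specProj_herm (ρ - (c : ℂ) • ω)) (specProj_idem _) h
  have h2 := trace_proj_le (specProj_herm (ρ - (c : ℂ) • ω)) (specProj_idem _) hX
  rw [Matrix.mul_sub, Matrix.trace_sub, Complex.sub_re] at h1
  unfold projTrace
  linarith

theorem projTrace_anti {ι : Type*} [Fintype ι] [DecidableEq ι] {ρ ω : Matrix ι ι ℂ}
    (hρ : ρ.PosSemidef) (hω : ω.PosSemidef) {c c' : ℝ} (hc : c' ≤ c) :
    projTrace ρ ω c ≤ projTrace ρ ω c' := by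
  have h1 := trace_mul_le_specProj (herm_sub hρ hω c') (specProj_herm (ρ - (c : ℂ) • ω))
    (specProj_idem _)
  have h2 := trace_proj_nonneg (specProj_herm (ρ - (c : ℂ) • ω)) (specProj_idem _)
    (smul_psd hω (sub_nonneg.2 hc))
  have e : ρ - (c' : ℂ) • ω = (ρ - (c : ℂ) • ω) + ((c - c' : ℝ) : ℂ) • ω := by
    push_cast
    rw [sub_smul]; abel
  unfold projTrace
  refine le_trans ?_ h1
  rw [e]
  rw [Matrix.mul_add, Matrix.trace_add, Complex.add_re]
  linarith

theorem projTrace_le_one {ι : Type*} [Fintype ι] [DecidableEq ι] {ρ ω : Matrix ι ι ℂ}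
    (hρ : IsState ρ) (hω : ω.PosSemidef) {c : ℝ} (hc : 0 ≤ c) :
    projTrace ρ ω c ≤ 1 := by
  have := projTrace_le (ρ := ρ) (ω := ω) (X := ρ) (c := c) hρ.1 (by
    rw [sub_sub_cancel]; exact smul_psd hω hc)
  rw [hρ.2] at this
  simpa using this

theorem cauchy_schwarz_psd {α m n : Type*} [Fintype m] [Fintype n]
    (s : Finset α) (A : α → Matrix m n ℂ) {M : Matrix n n ℂ} (hM : M.PosSemidef) :
    ((s.card : ℂ) • ∑ i ∈ s, A i * M * (A i)ᴴ
      - (∑ i ∈ s, A i) * M * (∑ i ∈ s, A i)ᴴ).PosSemidef := by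
  have h1 : (∑ i ∈ s, ∑ j ∈ s, (A i - A j) * M * (A i - A j)ᴴ).PosSemidef :=
    posSemidef_sum _ fun i _ => posSemidef_sum _ fun j _ => hM.mul_mul_conjTranspose_same _
  have h2 : ∑ i ∈ s, ∑ j ∈ s, (A i - A j) * M * (A i - A j)ᴴ =
      (2 : ℂ) • ((s.card : ℂ) • ∑ i ∈ s, A i * M * (A i)ᴴ
      - (∑ i ∈ s, A i) * M * (∑ i ∈ s, A i)ᴴ) := by
    have e1 : (∑ i ∈ s, A i) * M * (∑ i ∈ s, A i)ᴴ = ∑ i ∈ s, ∑ j ∈ s, A i * M * (A j)ᴴ := by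
      rw [conjTranspose_sum, Matrix.sum_mul, Matrix.sum_mul]
      exact Finset.sum_congr rfl fun i _ => by rw [Matrix.mul_sum]
    have e2 : (∑ i ∈ s, A i) * M * (∑ i ∈ s, A i)ᴴ = ∑ i ∈ s, ∑ j ∈ s, A j * M * (A i)ᴴ := by
      rw [e1, Finset.sum_comm]
    have e3 : ∀ i j, (A i - A j) * M * (A i - A j)ᴴ =
        A i * M * (A i)ᴴ + A j * M * (A j)ᴴ - A i * M * (A j)ᴴ - A j * M * (A i)ᴴ := by
      intro i j
      rw [conjTranspose_sub, Matrix.sub_mul, Matrix.sub_mul, Matrix.mul_sub, Matrix.mul_sub]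
      abel
    simp only [e3, Finset.sum_sub_distrib, Finset.sum_add_distrib]
    rw [← e1, ← e2, two_smul]
    simp only [Finset.sum_const, ← Finset.smul_sum, Nat.cast_smul_eq_nsmul]
    abel
  have h3 : ((s.card : ℂ) • ∑ i ∈ s, A i * M * (A i)ᴴ
      - (∑ i ∈ s, A i) * M * (∑ i ∈ s, A i)ᴴ) =
      (((1/2 : ℝ)) : ℂ) • ∑ i ∈ s, ∑ j ∈ s, (A i - A j) * M * (A i - A j)ᴴ := by
    rw [h2, smul_smul]; norm_num
  rw [h3]
  exact h1.smul (by exact_mod_cast (by norm_num : (0:ℝ) ≤ 1/2))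

theorem block_psd {a b : Type*} [Fintype a] [Fintype b] {M : Matrix (a × b) (a × b) ℂ}
    (hM : M.PosSemidef) (i : a) : (M.submatrix (fun p => (i, p)) (fun p => (i, p))).PosSemidef :=
  hM.submatrix _

theorem ptraceFst_eq {a b : Type*} [Fintype a] [Fintype b] (M : Matrix (a × b) (a × b) ℂ) :
    ptraceFst M = ∑ i : a, M.submatrix (fun p => (i, p)) (fun p => (i, p)) := by
  ext p q
  simp [ptraceFst, Matrix.sum_apply]

theorem ptraceFst_psd {a b : Type*} [Fintype a] [Fintype b] {M : Matrix (a × b) (a × b) ℂ}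
    (hM : M.PosSemidef) : (ptraceFst M).PosSemidef := by
  rw [ptraceFst_eq]
  exact posSemidef_sum _ fun i _ => block_psd hM i

theorem ptraceSnd_psd {a b : Type*} [Fintype a] [Fintype b] {M : Matrix (a × b) (a × b) ℂ}
    (hM : M.PosSemidef) : (ptraceSnd M).PosSemidef := by
  have : ptraceSnd M = ∑ i : b, M.submatrix (fun p => (p, i)) (fun p => (p, i)) := by
    ext p q
    simp [ptraceSnd, Matrix.sum_apply]
  rw [this]
  exact posSemidef_sum _ fun i _ => hM.submatrix _

theorem trace_ptraceSnd {a b : Type*} [Fintype a] [Fintype b] (M : Matrix (a × b) (a × b) ℂ) :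
    (ptraceSnd M).trace = M.trace := by
  simp [ptraceSnd, Matrix.trace, Fintype.sum_prod_type]

theorem trace_ptraceFst {a b : Type*} [Fintype a] [Fintype b] (M : Matrix (a × b) (a × b) ℂ) :
    (ptraceFst M).trace = M.trace := by
  simp [ptraceFst, Matrix.trace, Fintype.sum_prod_type_right]

theorem trace_kron_mul {a b : Type*} [Fintype a] [Fintype b] [DecidableEq b]
    (P : Matrix a a ℂ) (M : Matrix (a × b) (a × b) ℂ) :
    ((P ⊗ₖ (1 : Matrix b b ℂ)) * M).trace = (P * ptraceSnd M).trace := by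
  simp only [Matrix.trace, Matrix.diag, Matrix.mul_apply, Fintype.sum_prod_type, ptraceSnd,
    Matrix.of_apply, kroneckerMap_apply, Matrix.one_apply, mul_ite, mul_one, mul_zero, ite_mul,
    zero_mul, Finset.sum_ite_eq, Finset.mem_univ, if_true, Finset.mul_sum]
  refine Finset.sum_congr rfl fun i _ => ?_
  rw [Finset.sum_comm]

theorem ptraceFst_conj {a b : Type*} [Fintype a] [DecidableEq a] [Fintype b] [DecidableEq b]
    {V : Matrix a a ℂ} (hV : V * Vᴴ = 1) (M : Matrix (a × b) (a × b) ℂ) :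
    ptraceFst ((Vᴴ ⊗ₖ (1 : Matrix b b ℂ)) * M * (V ⊗ₖ (1 : Matrix b b ℂ))) = ptraceFst M := by
  ext p q
  simp only [Matrix.mul_apply, Fintype.sum_prod_type, ptraceFst,
    Matrix.of_apply, kroneckerMap_apply, Matrix.one_apply, mul_ite, mul_one, mul_zero, ite_mul,
    zero_mul, Finset.sum_ite_eq, Finset.sum_ite_eq', Finset.mem_univ, if_true, Finset.sum_mul]
  have h : ∀ x y, ∑ k, V x k * Vᴴ k y = if x = y then 1 else 0 := by
    intro x y
    rw [← Matrix.mul_apply, hV, Matrix.one_apply]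
  calc _ = ∑ x, ∑ y, (∑ k, V x k * Vᴴ k y) * M (y, p) (x, q) := by
        rw [Finset.sum_comm]
        refine Finset.sum_congr rfl fun x _ => ?_
        rw [Finset.sum_comm]
        refine Finset.sum_congr rfl fun y _ => ?_
        rw [Finset.sum_mul]
        exact Finset.sum_congr rfl fun k _ => by ring
    _ = _ := by simp only [h, ite_mul, one_mul, zero_mul, Finset.sum_ite_eq, Finset.mem_univ, if_true]

theorem block_bound_std {a b : Type*} [Fintype a] [DecidableEq a] [Fintype b] [DecidableEq b]
    (s : Finset a) {M : Matrix (a × b) (a × b) ℂ} (hM : M.PosSemidef) :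
    ((s.card : ℂ) • ((1 : Matrix a a ℂ) ⊗ₖ ptraceFst M) -
      (diagonal (fun i => if i ∈ s then (1 : ℂ) else 0) ⊗ₖ (1 : Matrix b b ℂ)) * M *
      (diagonal (fun i => if i ∈ s then (1 : ℂ) else 0) ⊗ₖ (1 : Matrix b b ℂ))ᴴ).PosSemidef := by
  let E : a → Matrix (a × b) (a × b) ℂ := fun i => diagonal (fun p => if p.1 = i then 1 else 0)
  have hE : (diagonal (fun i => if i ∈ s then (1 : ℂ) else 0) ⊗ₖ (1 : Matrix b b ℂ)) =
      ∑ i ∈ s, E i := by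
    rw [← diagonal_one, diagonal_kronecker_diagonal]
    ext p q
    simp only [E, Matrix.sum_apply, diagonal_apply]
    by_cases hpq : p = q <;> simp [hpq]
  have hT : ((1 : Matrix a a ℂ) ⊗ₖ ptraceFst M) - ∑ i ∈ s, E i * M * (E i)ᴴ =
      ∑ i : a, (diagonal (fun j => if j = i then (1 : ℂ) else 0)) ⊗ₖ
        (∑ k ∈ Finset.univ.filter (fun k => ¬ (k = i ∧ i ∈ s)),
          M.submatrix (fun p => (k, p)) (fun p => (k, p))) := by
    ext ⟨i, p⟩ ⟨j, q⟩
    have key : ∀ x : a, ∑ k ∈ Finset.univ.filter (fun k => ¬ (k = x ∧ x ∈ s)), M (k, p) (k, q) =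
        ∑ k, M (k, p) (k, q) - if x ∈ s then M (x, p) (x, q) else 0 := by
      intro x
      rw [eq_sub_iff_add_eq, ← Finset.sum_filter_add_sum_filter_not Finset.univ
        (fun k => ¬ (k = x ∧ x ∈ s))]
      congr 1
      by_cases hx : x ∈ s <;> simp [hx, Finset.filter_eq']
    simp only [E, diagonal_conjTranspose, Matrix.sub_apply, Matrix.sum_apply, kroneckerMap_apply,
      diagonal_mul, mul_diagonal, Matrix.one_apply, ptraceFst, Matrix.of_apply, diagonal_apply,
      Matrix.submatrix_apply, key]
    by_cases hij : i = j
    · subst hij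
      simp
    · simp [hij]
  have h1 : (((1 : Matrix a a ℂ) ⊗ₖ ptraceFst M) - ∑ i ∈ s, E i * M * (E i)ᴴ).PosSemidef := by
    rw [hT]
    refine posSemidef_sum _ fun i _ => PosSemidef.kronecker (PosSemidef.diagonal ?_)
      (posSemidef_sum _ fun k _ => block_psd hM k)
    intro j
    by_cases h : j = i <;> simp [h]
  have h2 := cauchy_schwarz_psd s E hM
  rw [hE]
  have h3 := (h1.smul (a := (s.card : ℂ)) (by positivity)).add h2
  convert h3 using 1
  rw [smul_sub]; abel

theorem block_bound {a b : Type*} [Fintype a] [DecidableEq a] [Fintype b] [DecidableEq b]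
    (s : Finset a) {M : Matrix (a × b) (a × b) ℂ} (hM : M.PosSemidef) {V P : Matrix a a ℂ}
    (hV : V * Vᴴ = 1) (hP : P = V * diagonal (fun i => if i ∈ s then (1 : ℂ) else 0) * Vᴴ) :
    ((s.card : ℂ) • ((1 : Matrix a a ℂ) ⊗ₖ ptraceFst M) -
      (P ⊗ₖ (1 : Matrix b b ℂ)) * M * (P ⊗ₖ (1 : Matrix b b ℂ))ᴴ).PosSemidef := by
  have hM' : ((Vᴴ ⊗ₖ (1 : Matrix b b ℂ)) * M * (V ⊗ₖ (1 : Matrix b b ℂ))).PosSemidef := by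
    have := hM.conjTranspose_mul_mul_same (V ⊗ₖ (1 : Matrix b b ℂ))
    rwa [conjTranspose_kronecker, conjTranspose_one] at this
  have h1 := (block_bound_std s hM').mul_mul_conjTranspose_same (V ⊗ₖ (1 : Matrix b b ℂ))
  rw [ptraceFst_conj hV] at h1
  convert h1 using 1
  rw [Matrix.mul_sub, Matrix.sub_mul]
  congr 1
  · rw [Matrix.mul_smul, Matrix.smul_mul, conjTranspose_kronecker, conjTranspose_one,
      ← mul_kronecker_mul, ← mul_kronecker_mul, Matrix.mul_one, hV]
    simp
  · have hp : P ⊗ₖ (1 : Matrix b b ℂ) = (V ⊗ₖ (1 : Matrix b b ℂ)) *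
      (diagonal (fun i => if i ∈ s then (1 : ℂ) else 0) ⊗ₖ (1 : Matrix b b ℂ)) *
        (Vᴴ ⊗ₖ (1 : Matrix b b ℂ)) := by
      rw [← mul_kronecker_mul, ← mul_kronecker_mul, hP]; simp
    rw [hp]
    simp only [conjTranspose_mul, conjTranspose_kronecker, conjTranspose_conjTranspose,
      conjTranspose_one, Matrix.mul_assoc]

theorem specProj_form {a : Type*} [Fintype a] [DecidableEq a] {A : Matrix a a ℂ}
    (hA : A.IsHermitian) : ∃ (V : Matrix a a ℂ) (s : Finset a), V * Vᴴ = 1 ∧ Vᴴ * V = 1 ∧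
      specProj A = V * diagonal (fun i => if i ∈ s then (1 : ℂ) else 0) * Vᴴ := by
  refine ⟨(hA.eigenvectorUnitary : Matrix a a ℂ),
    Finset.univ.filter (fun i => 0 ≤ hA.eigenvalues i), ?_, ?_, ?_⟩
  · rw [← star_eq_conjTranspose]; simp
  · rw [← star_eq_conjTranspose]; simp
  · unfold specProj
    rw [dif_pos hA]
    simp [star_eq_conjTranspose]

theorem main_finite {a b : Type*} [Fintype a] [DecidableEq a] [Fintype b] [DecidableEq b]
    {ρ : Matrix (a × b) (a × b) ℂ} (hρ : IsState ρ) {c c' : ℝ} (hc : 0 < c) (hcc : 2 / c ≤ c') :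
    projTrace ρ ((1 : Matrix a a ℂ) ⊗ₖ ptraceFst ρ) c' ≤
      2 * (1 - projTrace (ptraceSnd ρ) 1 c) := by
  have hA := ptraceSnd_psd hρ.1
  have htA : (ptraceSnd ρ).trace.re = 1 := by rw [trace_ptraceSnd, hρ.2]; simp
  have hH := herm_sub hA (PosSemidef.one (n := a) (R := ℂ)) c
  have hnn := projTrace_nonneg hA (PosSemidef.one (n := a) (R := ℂ)) c
  have hPh := specProj_herm (ptraceSnd ρ - (c : ℂ) • (1 : Matrix a a ℂ))
  have hPi := specProj_idem (ptraceSnd ρ - (c : ℂ) • (1 : Matrix a a ℂ))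
  obtain ⟨V, s, hV, hV', hform⟩ := specProj_form hH
  unfold projTrace at hnn
  have hle : projTrace (ptraceSnd ρ) 1 c = ((specProj (ptraceSnd ρ - (c : ℂ) • (1 : Matrix a a ℂ)) *
    (ptraceSnd ρ - (c : ℂ) • (1 : Matrix a a ℂ))).trace).re := rfl
  rw [hle]
  generalize specProj (ptraceSnd ρ - (c : ℂ) • (1 : Matrix a a ℂ)) = P at *
  have hcard : P.trace = s.card := by
    rw [hform, Matrix.trace_mul_cycle, hV', Matrix.one_mul, Matrix.trace_diagonal]
    simp
  have hexp : ((P * (ptraceSnd ρ - (c : ℂ) • (1 : Matrix a a ℂ))).trace).re =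
      (P * ptraceSnd ρ).trace.re - c * s.card := by
    rw [Matrix.mul_sub, Matrix.trace_sub, Matrix.mul_smul, Matrix.mul_one, Matrix.trace_smul, hcard]
    simp
  rw [hexp] at hnn hle ⊢
  have hPle := trace_proj_le hPh hPi hA
  have hs : (2 * s.card : ℝ) ≤ c' := by
    refine le_trans ?_ hcc
    rw [le_div_iff₀ hc]
    nlinarith
  set Q := P ⊗ₖ (1 : Matrix b b ℂ) with hQ
  have hQh : Qᴴ = Q := by rw [hQ, conjTranspose_kronecker, hPh, conjTranspose_one]
  have hQi : Q * Q = Q := by rw [hQ, ← mul_kronecker_mul, hPi, Matrix.mul_one]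
  have hbb := block_bound s hρ.1 hV hform
  rw [← hQ] at hbb
  set ω := (1 : Matrix a a ℂ) ⊗ₖ ptraceFst ρ
  have hω : ω.PosSemidef := PosSemidef.one.kronecker (ptraceFst_psd hρ.1)
  have hX : ((2 : ℝ) : ℂ) • ((1 - Q) * ρ * (1 - Q)ᴴ) |>.PosSemidef :=
    smul_psd (hρ.1.mul_mul_conjTranspose_same _) (by norm_num)
  have hmain := projTrace_le (ρ := ρ) (ω := ω) (c := c') hX (by
    have h1 := hρ.1.mul_mul_conjTranspose_same (Q - (1 - Q))
    have h2 := smul_psd hbb (c := 2) (by norm_num)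
    have h3 := smul_psd hω (sub_nonneg.2 hs)
    convert (h1.add h2).add h3 using 1
    simp only [conjTranspose_sub, conjTranspose_one, Matrix.sub_mul, Matrix.mul_sub,
      Matrix.one_mul, Matrix.mul_one, hQh]
    push_cast
    module)
  refine hmain.trans ?_
  have ht : ((1 - Q) * ρ * (1 - Q)ᴴ).trace = ρ.trace - (P * ptraceSnd ρ).trace := by
    have e : (1 - Q)ᴴ * (1 - Q) = 1 - Q := by
      rw [conjTranspose_sub, conjTranspose_one, hQh, Matrix.sub_mul, Matrix.mul_sub, Matrix.mul_sub,
        hQi]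
      simp
    rw [Matrix.trace_mul_cycle, e, Matrix.sub_mul, Matrix.trace_sub, Matrix.one_mul,
      hQ, trace_kron_mul]
  rw [Matrix.trace_smul, ht, hρ.2]
  simp only [smul_eq_mul, Complex.re_ofReal_mul, Complex.sub_re, Complex.one_re]
  have : 0 ≤ c * s.card := by positivity
  linarith

theorem mem_inf_of_lt {d : ℕ} (hd : 0 < d) {ι : ℕ → Type} [∀ n, Fintype (ι n)]
    [∀ n, DecidableEq (ι n)] {ρ ω : ∀ n, Matrix (ι n) (ι n) ℂ} (hρ : ∀ n, IsState (ρ n))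
    (hω : ∀ n, (ω n).PosSemidef) (ht : ∀ n, (ω n).trace.re = (d : ℝ) ^ n) {γ : ℝ}
    (hγ : γ < - Real.log d) :
    Tendsto (fun n : ℕ => projTrace (ρ n) (ω n) (Real.exp (n * γ))) atTop (nhds 1) := by
  have hd' : (0 : ℝ) < d := by exact_mod_cast hd
  have hlim : Tendsto (fun n : ℕ => 1 - (Real.exp (γ + Real.log d)) ^ n) atTop (nhds 1) := by
    have := tendsto_pow_atTop_nhds_zero_of_lt_one (Real.exp_pos (γ + Real.log d)).le
      (by rw [Real.exp_lt_one_iff]; linarith)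
    simpa using this.const_sub 1
  refine tendsto_of_tendsto_of_tendsto_of_le_of_le hlim tendsto_const_nhds (fun n => ?_) (fun n => ?_)
  · have := projTrace_ge (hρ n).1 (hω n) (Real.exp (n * γ))
    rw [(hρ n).2, ht] at this
    refine le_trans (le_of_eq ?_) this
    rw [Real.exp_add, Real.exp_log hd', mul_pow, ← Real.exp_nat_mul]
    simp
  · exact projTrace_le_one (hρ n) (hω n) (Real.exp_pos _).le

theorem rate_inf_le_sup {ι : ℕ → Type} [∀ n, Fintype (ι n)]
    [∀ n, DecidableEq (ι n)] {ρ ω : ∀ n, Matrix (ι n) (ι n) ℂ} (hρ : ∀ n, IsState (ρ n))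
    (hω : ∀ n, (ω n).PosSemidef) {γ γ' : ℝ}
    (h1 : Tendsto (fun n : ℕ => projTrace (ρ n) (ω n) (Real.exp (n * γ))) atTop (nhds 1))
    (h0 : Tendsto (fun n : ℕ => projTrace (ρ n) (ω n) (Real.exp (n * γ'))) atTop (nhds 0)) :
    γ ≤ γ' := by
  by_contra! h
  have := le_of_tendsto_of_tendsto' h1 h0 (fun n => projTrace_anti (hρ n).1 (hω n)
    (Real.exp_le_exp.2 (mul_le_mul_of_nonneg_left h.le (Nat.cast_nonneg n))))
  linarith

/-- For bipartite sequences with `dim H^A_n = d ^ n`,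
`−log d ≤ −S̄(A) ≤ S̲(A|B) ≤ S̄(A|B) ≤ log d`. -/
theorem conditional_entropy_bounds (d : ℕ) {B : ℕ → Type}
    [∀ n, Fintype (B n)] [∀ n, DecidableEq (B n)]
    (ρ : ∀ n, Matrix (Fin (d ^ n) × B n) (Fin (d ^ n) × B n) ℂ)
    (hρ : ∀ n, IsState (ρ n)) :
    - Real.log d ≤ - Ssup (fun n => ptraceSnd (ρ n)) ∧
    - Ssup (fun n => ptraceSnd (ρ n)) ≤
      - Dsup ρ (fun n => (1 : Matrix (Fin (d ^ n)) (Fin (d ^ n)) ℂ) ⊗ₖ ptraceFst (ρ n)) ∧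
    - Dsup ρ (fun n => (1 : Matrix (Fin (d ^ n)) (Fin (d ^ n)) ℂ) ⊗ₖ ptraceFst (ρ n)) ≤
      - Dinf ρ (fun n => (1 : Matrix (Fin (d ^ n)) (Fin (d ^ n)) ℂ) ⊗ₖ ptraceFst (ρ n)) ∧
    - Dinf ρ (fun n => (1 : Matrix (Fin (d ^ n)) (Fin (d ^ n)) ℂ) ⊗ₖ ptraceFst (ρ n)) ≤
      Real.log d := by
  have hd : 0 < d := by
    rcases Nat.eq_zero_or_pos d with h | h
    · subst h
      have h1 := (hρ 1).2
      have : IsEmpty (Fin (0 ^ 1)) := by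
        rw [pow_one]; infer_instance
      simp [Matrix.trace] at h1
    · exact h
  have hA : ∀ n, IsState (ptraceSnd (ρ n)) := fun n =>
    ⟨ptraceSnd_psd (hρ n).1, by rw [trace_ptraceSnd, (hρ n).2]⟩
  have hω : ∀ n, ((1 : Matrix (Fin (d ^ n)) (Fin (d ^ n)) ℂ) ⊗ₖ ptraceFst (ρ n)).PosSemidef :=
    fun n => PosSemidef.one.kronecker (ptraceFst_psd (hρ n).1)
  have hωt : ∀ n, ((1 : Matrix (Fin (d ^ n)) (Fin (d ^ n)) ℂ) ⊗ₖ ptraceFst (ρ n)).trace.re =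
      (d : ℝ) ^ n := fun n => by
    rw [trace_kronecker, trace_ptraceFst, (hρ n).2, mul_one, trace_one, Fintype.card_fin]
    push_cast
    exact_mod_cast Complex.ofReal_re ((d : ℝ) ^ n)
  have h1t : ∀ n, (1 : Matrix (Fin (d ^ n)) (Fin (d ^ n)) ℂ).trace.re = (d : ℝ) ^ n := fun n => by
    rw [trace_one, Fintype.card_fin]
    push_cast
    exact_mod_cast Complex.ofReal_re ((d : ℝ) ^ n)
  -- the three sets of exponents
  set SA : Set ℝ := {γ : ℝ | Tendsto (fun n : ℕ => projTrace (ptraceSnd (ρ n))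
    (1 : Matrix (Fin (d ^ n)) (Fin (d ^ n)) ℂ) (Real.exp (n * γ))) atTop (nhds 1)} with hSA
  set SI : Set ℝ := {γ : ℝ | Tendsto (fun n : ℕ => projTrace (ρ n)
    ((1 : Matrix (Fin (d ^ n)) (Fin (d ^ n)) ℂ) ⊗ₖ ptraceFst (ρ n)) (Real.exp (n * γ)))
    atTop (nhds 1)} with hSI
  set SS : Set ℝ := {γ : ℝ | Tendsto (fun n : ℕ => projTrace (ρ n)
    ((1 : Matrix (Fin (d ^ n)) (Fin (d ^ n)) ℂ) ⊗ₖ ptraceFst (ρ n)) (Real.exp (n * γ)))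
    atTop (nhds 0)} with hSS
  have memA : ∀ γ, γ < - Real.log d → γ ∈ SA := fun γ hγ =>
    mem_inf_of_lt hd hA (fun n => PosSemidef.one) h1t hγ
  have memI : ∀ γ, γ < - Real.log d → γ ∈ SI := fun γ hγ =>
    mem_inf_of_lt hd hρ hω hωt hγ
  have hIS : ∀ γ ∈ SI, ∀ γ' ∈ SS, γ ≤ γ' := fun γ h γ' h' => rate_inf_le_sup hρ hω h h'
  have hAS : ∀ γ ∈ SA, ∀ ε > 0, -γ + ε ∈ SS := by
    intro γ hγ ε hε
    have hu : Tendsto (fun n : ℕ => 2 * (1 - projTrace (ptraceSnd (ρ n))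
        (1 : Matrix (Fin (d ^ n)) (Fin (d ^ n)) ℂ) (Real.exp (n * γ)))) atTop (nhds 0) := by
      have := (Tendsto.const_sub 1 hγ).const_mul 2
      simpa using this
    have hev : ∀ᶠ n : ℕ in atTop, 2 ≤ Real.exp (n * ε) :=
      (Real.tendsto_exp_atTop.comp
        (tendsto_natCast_atTop_atTop.atTop_mul_const hε)).eventually_ge_atTop 2
    refine tendsto_of_tendsto_of_tendsto_of_le_of_le' tendsto_const_nhds hu
      (Eventually.of_forall fun n => projTrace_nonneg (hρ n).1 (hω n) _) ?_
    filter_upwards [hev] with n hn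
    refine main_finite (hρ n) (Real.exp_pos _) ?_
    rw [div_le_iff₀ (Real.exp_pos _), ← Real.exp_add]
    refine hn.trans (le_of_eq ?_)
    congr 1; ring
  have SSlow : ∀ γ' ∈ SS, - Real.log d ≤ γ' := fun γ' h' =>
    le_of_forall_lt fun γ hγ => by
      obtain ⟨m, hm1, hm2⟩ := exists_between hγ
      exact hm1.trans_le (hIS m (memI m hm2) γ' h')
  have SSbdd : BddBelow SS := ⟨_, SSlow⟩
  have SAne : SA.Nonempty := ⟨- Real.log d - 1, memA _ (by linarith)⟩
  have SIne : SI.Nonempty := ⟨- Real.log d - 1, memI _ (by linarith)⟩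
  have SSne : SS.Nonempty := ⟨_, hAS _ SAne.some_mem 1 one_pos⟩
  have SAbdd : BddAbove SA := ⟨Real.log d + 1, fun γ hγ => by
    have := SSlow _ (hAS γ hγ 1 one_pos)
    linarith⟩
  have SIbdd : BddAbove SI := ⟨SSne.some, fun γ hγ => hIS γ hγ _ SSne.some_mem⟩
  have eA : Ssup (fun n => ptraceSnd (ρ n)) = - sSup SA := rfl
  have eS : Dsup ρ (fun n => (1 : Matrix (Fin (d ^ n)) (Fin (d ^ n)) ℂ) ⊗ₖ ptraceFst (ρ n)) =
    sInf SS := rfl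
  have eI : Dinf ρ (fun n => (1 : Matrix (Fin (d ^ n)) (Fin (d ^ n)) ℂ) ⊗ₖ ptraceFst (ρ n)) =
    sSup SI := rfl
  rw [eA, eS, eI, neg_neg]
  refine ⟨?_, ?_, ?_, ?_⟩
  · refine le_of_forall_lt fun γ hγ => ?_
    obtain ⟨m, hm1, hm2⟩ := exists_between hγ
    exact hm1.trans_le (le_csSup SAbdd (memA m hm2))
  · refine csSup_le SAne fun γ hγ => ?_
    have : sInf SS ≤ -γ := le_of_forall_pos_le_add fun ε hε => csInf_le SSbdd (hAS γ hγ ε hε)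
    linarith
  · exact neg_le_neg (csSup_le SIne fun γ hγ => le_csInf SSne fun γ' h' => hIS γ hγ γ' h')
  · rw [neg_le]
    refine le_of_forall_lt fun γ hγ => ?_
    obtain ⟨m, hm1, hm2⟩ := exists_between hγ
    exact hm1.trans_le (le_csSup SIbdd (memI m hm2))
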